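/- arXiv:2602.14673 — 4 statements merged into one kernel-verified Lean document; each statement's English description precedes it below -/
import Mathlib

section
/- Let κ : [0,∞) → [1,∞) be a monotone increasing concave function with κ(t)/t → 0 as t → ∞. Let (X,d) be a metric space with a basepoint o, and write |x| = d(o,x). Then for every A ≥ 0 there exists a constant C ≥ 1 (depending only on A and κ) such that for all x, y ∈ X with d(x,y) ≤ A·κ(|x|), one has (1/C)·κ(|x|) ≤ κ(|y|) ≤ C·κ(|x|). -/
open Filter

theorem ConcaveOn.map_two_mul_le {f : ℝ → ℝ} (hf : ConcaveOn ℝ (Set.Ici 0) f)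
    (h0 : 0 ≤ f 0) {t : ℝ} (ht : 0 ≤ t) : f (2 * t) ≤ 2 * f t := by
  have h := hf.2 (Set.mem_Ici.2 le_rfl) (Set.mem_Ici.2 (by positivity : 0 ≤ 2 * t))
    (by norm_num : (0 : ℝ) ≤ 1 / 2) (by norm_num : (0 : ℝ) ≤ 1 / 2) (by norm_num)
  have e : (1 / 2 : ℝ) • (0 : ℝ) + (1 / 2 : ℝ) • (2 * t) = t := by
    simp only [smul_eq_mul]; ring
  rw [e] at h
  simp only [smul_eq_mul] at h
  linarith

/-- Lemma 2.8, first assertion: For `κ : [0,∞) → [1,∞)` monotone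
increasing, concave and sublinear, and a metric space `X` with basepoint `o`
(`|x| = d(o,x)`): for every `A ≥ 0` there is `C ≥ 1` such that `d(x,y) ≤ A·κ(|x|)`
implies `(1/C)·κ(|x|) ≤ κ(|y|) ≤ C·κ(|x|)`. -/
theorem stmt_8 {X : Type*} [MetricSpace X] (o : X) (κ : ℝ → ℝ)
    (hκ1 : ∀ t, 0 ≤ t → 1 ≤ κ t)
    (hmono : ∀ ⦃s t : ℝ⦄, 0 ≤ s → s ≤ t → κ s ≤ κ t)
    (hconc : ConcaveOn ℝ (Set.Ici 0) κ)
    (hsub : Tendsto (fun t => κ t / t) atTop (nhds 0)) :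
    ∀ A : ℝ, 0 ≤ A → ∃ C : ℝ, 1 ≤ C ∧ ∀ x y : X,
      dist x y ≤ A * κ (dist o x) →
        (1 / C) * κ (dist o x) ≤ κ (dist o y) ∧ κ (dist o y) ≤ C * κ (dist o x) := by
  intro A hA
  have hε : (0 : ℝ) < 1 / (2 * A + 1) := by positivity
  obtain ⟨T, hT, hT0⟩ := ((eventually_forall_ge_atTop.2
    (hsub.eventually_lt_const hε)).and (eventually_gt_atTop 0)).exists
  have hsmall : ∀ s, T ≤ s → A * κ s ≤ s / 2 := by
    intro s hs
    have hs0 : 0 < s := hT0.trans_le hs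
    have h := hT s hs
    rw [div_lt_div_iff₀ hs0 (by positivity)] at h
    nlinarith [hκ1 s hs0.le]
  have hdouble : ∀ t, 0 ≤ t → κ (2 * t) ≤ 2 * κ t := fun t ht =>
    hconc.map_two_mul_le (zero_le_one.trans (hκ1 0 le_rfl)) ht
  have hκT := hκ1 T hT0.le
  have hAκT : 0 ≤ A * κ T := by positivity
  have hM := hκ1 (T + A * κ T) (by positivity)
  set M := κ (T + A * κ T)
  refine ⟨M + 2, by linarith, fun x y hxy => ?_⟩
  have hs0 : 0 ≤ dist o x := dist_nonneg
  have ht0 : 0 ≤ dist o y := dist_nonneg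
  have hyx : dist o y ≤ dist o x + dist x y := dist_triangle o x y
  have hxy' : dist o x ≤ dist o y + dist x y := by
    simpa only [dist_comm y x] using dist_triangle o y x
  have hκx := hκ1 _ hs0
  have hκy := hκ1 _ ht0
  rw [one_div, inv_mul_le_iff₀ (by linarith)]
  rcases le_total T (dist o x) with h | h
  · have hA := hsmall _ h
    have hx : κ (dist o x) ≤ κ (2 * dist o y) := hmono hs0 (by linarith)
    have hy : κ (dist o y) ≤ κ (2 * dist o x) := hmono ht0 (by linarith)
    have hx2 := hdouble _ ht0
    have hy2 := hdouble _ hs0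
    constructor <;> nlinarith
  · have hA := mul_le_mul_of_nonneg_left (hmono hs0 h) hA
    have hx : κ (dist o x) ≤ M := hmono hs0 (by linarith)
    have hy : κ (dist o y) ≤ M := hmono ht0 (by linarith)
    constructor <;> nlinarith
end

section
/- Let κ : [0,∞) → [1,∞) be a monotone increasing concave function with κ(t)/t → 0 as t → ∞, and let ρ_κ(t) = ∫₀^t ds/κ(s). Let (X,d) be a metric space with a basepoint o, and write |x| = d(o,x). Then for every A ≥ 0 there exists a constant C ≥ 1 (depending only on A and κ) such that for all x, y ∈ X with d(x,y) ≤ A·κ(|x|), one has |ρ_κ(|y|) − ρ_κ(|x|)| ≤ C. -/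
open Filter

/-- The integral of `κ⁻¹` varies by at most `m⁻¹ * |b - a|` between two nonnegative points
`a`, `b` when `κ` is monotone and at least `m > 0` above `min a b`. -/
theorem abs_integral_inv_sub_le {κ : ℝ → ℝ} (hκ1 : ∀ t, 0 ≤ t → 1 ≤ κ t)
    (hmono : ∀ ⦃s t : ℝ⦄, 0 ≤ s → s ≤ t → κ s ≤ κ t) {a b m : ℝ} (ha : 0 ≤ a) (hb : 0 ≤ b)
    (hm : 0 < m) (hle : ∀ s, min a b ≤ s → m ≤ κ s) :
    |(∫ s in (0 : ℝ)..b, (κ s)⁻¹) - ∫ s in (0 : ℝ)..a, (κ s)⁻¹| ≤ m⁻¹ * |b - a| := by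
  have hint : ∀ t, 0 ≤ t → IntervalIntegrable (fun s => (κ s)⁻¹) MeasureTheory.volume 0 t := by
    intro t ht
    apply AntitoneOn.intervalIntegrable
    rw [Set.uIcc_of_le ht]
    intro u hu v _ huv
    exact inv_anti₀ (one_pos.trans_le (hκ1 u hu.1)) (hmono hu.1 huv)
  rw [intervalIntegral.integral_interval_sub_left (hint b hb) (hint a ha), ← Real.norm_eq_abs]
  apply intervalIntegral.norm_integral_le_of_norm_le_const
  intro s hs
  have hms := hle s hs.1.le
  rw [Real.norm_eq_abs, abs_of_pos (inv_pos.2 (hm.trans_le hms))]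
  exact inv_anti₀ hm hms

/-- A concave function on `[0, ∞)` that is nonnegative at `0` at most halves when its argument
is halved. -/
theorem ConcaveOn.half_le_map_half {κ : ℝ → ℝ} (hconc : ConcaveOn ℝ (Set.Ici 0) κ)
    (h0 : 0 ≤ κ 0) {a : ℝ} (ha : 0 ≤ a) : κ a / 2 ≤ κ (a / 2) := by
  have h := hconc.2 (Set.mem_Ici.2 ha) (Set.mem_Ici.2 le_rfl)
    (by norm_num : (0 : ℝ) ≤ 1 / 2) (by norm_num : (0 : ℝ) ≤ 1 / 2) (by norm_num)
  simp only [smul_eq_mul, mul_zero, add_zero] at h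
  rw [show 1 / 2 * a = a / 2 by ring] at h
  linarith

/-- A sublinear function satisfies `A * κ t ≤ t / 2` for all large `t`. -/
theorem exists_mul_le_half_of_sublinear {κ : ℝ → ℝ}
    (hsub : Tendsto (fun t => κ t / t) atTop (nhds 0)) (A : ℝ) :
    ∃ T : ℝ, 0 ≤ T ∧ ∀ t, T ≤ t → A * κ t ≤ t / 2 := by
  have h : Tendsto (fun t => A * (κ t / t)) atTop (nhds 0) := by
    simpa using hsub.const_mul A
  obtain ⟨T, hT⟩ := eventually_atTop.1 (h.eventually_le_const (by norm_num : (0 : ℝ) < 1 / 2))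
  refine ⟨max T 1, by positivity, fun t ht => ?_⟩
  have ht0 : 0 < t := one_pos.trans_le ((le_max_right T 1).trans ht)
  have h1 := hT t ((le_max_left T 1).trans ht)
  rw [← mul_div_assoc, div_le_iff₀ ht0] at h1
  linarith

/-- Lemma 2.8, second assertion: For `κ : [0,∞) → [1,∞)` monotone
increasing, concave and sublinear, `ρ_κ(t) = ∫₀^t ds/κ(s)`, and a metric space `X`
with basepoint `o`: for every `A ≥ 0` there is `C ≥ 1` such that `d(x,y) ≤ A·κ(|x|)`
implies `|ρ_κ(|y|) − ρ_κ(|x|)| ≤ C`. -/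
theorem stmt_9 {X : Type*} [MetricSpace X] (o : X) (κ : ℝ → ℝ)
    (hκ1 : ∀ t, 0 ≤ t → 1 ≤ κ t)
    (hmono : ∀ ⦃s t : ℝ⦄, 0 ≤ s → s ≤ t → κ s ≤ κ t)
    (hconc : ConcaveOn ℝ (Set.Ici 0) κ)
    (hsub : Tendsto (fun t => κ t / t) atTop (nhds 0))
    (ρ : ℝ → ℝ) (hρ : ∀ t, ρ t = ∫ s in (0 : ℝ)..t, (κ s)⁻¹) :
    ∀ A : ℝ, 0 ≤ A → ∃ C : ℝ, 1 ≤ C ∧ ∀ x y : X,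
      dist x y ≤ A * κ (dist o x) →
        |ρ (dist o y) - ρ (dist o x)| ≤ C := by
  intro A hA
  obtain ⟨T, hT0, hT⟩ := exists_mul_le_half_of_sublinear hsub A
  have hκT : 0 ≤ A * κ T := mul_nonneg hA (zero_le_one.trans (hκ1 T hT0))
  refine ⟨1 + 2 * A + A * κ T, by linarith, fun x y hxy => ?_⟩
  have ha : 0 ≤ dist o x := dist_nonneg
  have hb : 0 ≤ dist o y := dist_nonneg
  have hab : |dist o y - dist o x| ≤ A * κ (dist o x) := by
    refine le_trans ?_ hxy
    rw [dist_comm o y, dist_comm o x, dist_comm x y]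
    exact abs_dist_sub_le y x o
  generalize dist o x = a at *
  generalize dist o y = b at *
  rw [hρ, hρ]
  rcases le_total T a with h | h
  · have hκa : 0 < κ a := one_pos.trans_le (hκ1 a ha)
    have hmin : a / 2 ≤ min a b := by
      have h1 := hT a h
      have h2 := (abs_le.1 hab).1
      exact le_min (by linarith) (by linarith)
    have key := abs_integral_inv_sub_le hκ1 hmono ha hb (half_pos hκa) fun s hs =>
      (hconc.half_le_map_half (zero_le_one.trans (hκ1 0 le_rfl)) ha).trans
        (hmono (by positivity) (hmin.trans hs))
    have h3 : (κ a / 2)⁻¹ * |b - a| ≤ (κ a / 2)⁻¹ * (A * κ a) := by gcongr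
    have h4 : (κ a / 2)⁻¹ * (A * κ a) = 2 * A := by field_simp
    linarith
  · have key := abs_integral_inv_sub_le hκ1 hmono ha hb one_pos fun s hs =>
      hκ1 s ((le_min ha hb).trans hs)
    have h1 : A * κ a ≤ A * κ T := mul_le_mul_of_nonneg_left (hmono ha h) hA
    rw [inv_one, one_mul] at key
    linarith
end

section
/- Let (Z,d) be a metric space with at least two points which is uniformly perfect with constant S > 1, meaning: for every x ∈ Z and every r with 0 < r < diam(Z), there exists y ∈ Z with r/S < d(x,y) ≤ r. Set s = log 2 / log(2S+1). Then there exists c > 0 such that for every x ∈ Z, every 0 < r < R < diam(Z), and every finite set F of points of Z such that the closed ball B(x,R) is covered by the closed balls of radius r centered at points of F, one has |F| ≥ c·(R/r)^s. -/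
/-- In a uniformly perfect space, each ball of radius `R` contains `2 ^ n` centers of pairwise
separated balls of radius `R / (2 * S + 1) ^ n`. -/
theorem exists_separated_finset_card_two_pow {Z : Type*} [MetricSpace Z] {S : ℝ} (hS : 1 < S)
    (hup : ∀ (x : Z) (r : ℝ), 0 < r →
      ENNReal.ofReal r < Metric.ediam (Set.univ : Set Z) →
      ∃ y : Z, r / S < dist x y ∧ dist x y ≤ r)
    (n : ℕ) (x : Z) {R : ℝ} (hR : 0 < R)
    (hRd : ENNReal.ofReal R < Metric.ediam (Set.univ : Set Z)) :
    ∃ T : Finset Z, T.card = 2 ^ n ∧ (∀ p ∈ T, dist p x ≤ R - R / (2 * S + 1) ^ n) ∧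
      ∀ p ∈ T, ∀ q ∈ T, p ≠ q → 2 * (R / (2 * S + 1) ^ n) < dist p q := by
  classical
  induction n generalizing x R with
  | zero => exact ⟨{x}, by simp, by simp, by simp⟩
  | succ n ih =>
    set L : ℝ := 2 * S + 1 with hL
    have hL0 : 0 < L := by linarith
    have hdiv : R / L ≤ R := div_le_self hR.le (by linarith)
    have hRL : 0 < R / L := by positivity
    have hpow : R / L / L ^ n = R / L ^ (n + 1) := by rw [div_div, pow_succ']
    have hRmul : R = R / L * L := by field_simp
    have hρ : R - R / L = 2 * S * (R / L) := by
      calc R - R / L = R / L * L - R / L := by rw [← hRmul]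
        _ = 2 * S * (R / L) := by rw [hL]; ring
    obtain ⟨y, hy, hy'⟩ := hup x (R - R / L) (by rw [hρ]; positivity)
      ((ENNReal.ofReal_le_ofReal (by linarith)).trans_lt hRd)
    have hsep : 2 * (R / L) < dist x y := by
      have : (R - R / L) / S = 2 * (R / L) := by rw [hρ]; field_simp
      linarith
    have hd := (ENNReal.ofReal_le_ofReal hdiv).trans_lt hRd
    obtain ⟨T, hTc, hTx, hT⟩ := ih x hRL hd
    obtain ⟨U, hUc, hUy, hU⟩ := ih y hRL hd
    rw [hpow] at hTx hT hUy hU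
    have hε : 0 < R / L ^ (n + 1) := by positivity
    have hcross : ∀ p ∈ T, ∀ q ∈ U, 2 * (R / L ^ (n + 1)) < dist p q := by
      intro p hp q hq
      have h₁ := dist_triangle4 x p q y
      rw [dist_comm x p] at h₁
      linarith [hTx p hp, hUy q hq]
    refine ⟨T ∪ U, ?_, ?_, ?_⟩
    · rw [Finset.card_union_of_disjoint, hTc, hUc, pow_succ, mul_two]
      refine Finset.disjoint_left.2 fun p hp hq => ?_
      have := hcross p hp p hq
      rw [dist_self] at this
      linarith
    · intro p hp
      rcases Finset.mem_union.1 hp with hp | hp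
      · linarith [hTx p hp]
      · have := dist_triangle p y x
        rw [dist_comm y x] at this
        linarith [hUy p hp]
    · intro p hp q hq hpq
      rcases Finset.mem_union.1 hp with hp | hp <;> rcases Finset.mem_union.1 hq with hq | hq
      · exact hT p hp q hq hpq
      · exact hcross p hp q hq
      · rw [dist_comm]; exact hcross q hq p hp
      · exact hU p hp q hq hpq


/-- Proposition 7.1: If `(Z,d)` has at least two points and is uniformly
perfect with constant `S > 1`, then with `s = log 2 / log(2S+1)` there exists `c > 0`
such that any cover of a closed ball `B(x,R)` (with `0 < r < R < diam Z`) by closed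
`r`-balls centered at a finite set `F` satisfies `|F| ≥ c·(R/r)^s`. -/
theorem stmt_15 {Z : Type*} [MetricSpace Z] (hZ : ∃ x y : Z, x ≠ y)
    (S : ℝ) (hS : 1 < S)
    (hup : ∀ (x : Z) (r : ℝ), 0 < r →
      ENNReal.ofReal r < EMetric.diam (Set.univ : Set Z) →
      ∃ y : Z, r / S < dist x y ∧ dist x y ≤ r) :
    ∃ c : ℝ, 0 < c ∧ ∀ (x : Z) (r R : ℝ) (F : Finset Z),
      0 < r → r < R → ENNReal.ofReal R < EMetric.diam (Set.univ : Set Z) →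
      Metric.closedBall x R ⊆ ⋃ y ∈ F, Metric.closedBall y r →
      c * (R / r) ^ (Real.log 2 / Real.log (2 * S + 1)) ≤ (F.card : ℝ) := by
  have hL : 1 < 2 * S + 1 := by linarith
  refine ⟨1 / 2, by norm_num, fun x r R F hr hrR hRd hcov => ?_⟩
  have hR : 0 < R := hr.trans hrR
  obtain ⟨n, hn, hn'⟩ := exists_nat_pow_near ((one_le_div hr).2 hrR.le) hL
  obtain ⟨T, hTc, hTx, hT⟩ := exists_separated_finset_card_two_pow hS hup n x hR hRd
  have hrn : r ≤ R / (2 * S + 1) ^ n := by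
    rw [le_div_iff₀ hr] at hn
    rw [le_div_iff₀ (by positivity)]
    linarith
  have hmem : ∀ p ∈ T, ∃ y ∈ F, dist p y ≤ r := by
    intro p hp
    have hpR : p ∈ Metric.closedBall x R := by
      rw [Metric.mem_closedBall]
      linarith [hTx p hp]
    simpa using hcov hpR
  choose! f hf hfd using hmem
  have hcard : T.card ≤ F.card := by
    refine Finset.card_le_card_of_injOn f hf fun p hp q hq hpq => ?_
    by_contra hne
    have h₁ := hT p hp q hq hne
    have h₂ := dist_triangle_right p q (f p)
    have h₃ := hfd q hq
    rw [← hpq] at h₃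
    linarith [hfd p hp]
  have hlog : (2 * S + 1) ^ (Real.log 2 / Real.log (2 * S + 1)) = 2 := by
    rw [Real.rpow_def_of_pos (by linarith), mul_div_cancel₀ _ (Real.log_pos hL).ne',
      Real.exp_log two_pos]
  have hs : 0 ≤ Real.log 2 / Real.log (2 * S + 1) :=
    div_nonneg (Real.log_nonneg one_le_two) (Real.log_pos hL).le
  have hpow : (R / r) ^ (Real.log 2 / Real.log (2 * S + 1)) ≤ 2 ^ (n + 1) := by
    calc (R / r) ^ (Real.log 2 / Real.log (2 * S + 1))
        ≤ ((2 * S + 1) ^ (n + 1)) ^ (Real.log 2 / Real.log (2 * S + 1)) :=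
          Real.rpow_le_rpow (by positivity) hn'.le hs
      _ = 2 ^ (n + 1) := by rw [← Real.rpow_pow_comm (by linarith), hlog]
  have hF : (2 : ℝ) ^ n ≤ F.card := by exact_mod_cast hTc ▸ hcard
  rw [pow_succ] at hpow
  linarith
end

section
/- Let (Z,d) be a compact metric space with at least two points which is doubling (there exists M ∈ ℕ such that every closed ball of radius 2r can be covered by at most M closed balls of radius r) and uniformly perfect with constant S > 1 (for every x ∈ Z and every 0 < r < diam(Z), there exists y ∈ Z with r/S < d(x,y) ≤ r). Then the Hausdorff dimension of Z satisfies dim_H(Z) ≥ log 2 / log(2S+1) > 0. -/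
open Filter Topology Set Metric
open scoped NNReal ENNReal

/-- A map from binary sequences to a metric space which separates sequences first differing at
the index `n` by at least `δ * t ^ n` has range of Hausdorff dimension at least `s`, where
`t ^ s = 1 / 2`. -/
lemma le_dimH_range_of_binary_separated {Z : Type*} [MetricSpace Z] (φ : (ℕ → Fin 2) → Z)
    {t δ : ℝ} (ht : 0 < t) (hδ : 0 < δ) {s : ℝ≥0} (hs : 0 < s) (hts : t ^ (s : ℝ) = 2⁻¹)
    (hφ : ∀ (a b : ℕ → Fin 2) (n : ℕ), (∀ i < n, a i = b i) → a n ≠ b n →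
      δ * t ^ n ≤ dist (φ a) (φ b)) :
    (s : ℝ≥0∞) ≤ dimH (range φ) := by
  have hsep (a b : ℕ → Fin 2) (hab : a ≠ b) : ∃ n, (∀ i < n, a i = b i) ∧
      δ * t ^ n ≤ dist (φ a) (φ b) :=
    ⟨PiNat.firstDiff a b, fun _ hi ↦ PiNat.apply_eq_of_lt_firstDiff hi,
      hφ a b _ (fun _ hi ↦ PiNat.apply_eq_of_lt_firstDiff hi) (PiNat.apply_firstDiff_ne hab)⟩
  have hinj : Function.Injective φ := by
    intro a b hab
    by_contra hne
    obtain ⟨n, -, h⟩ := hsep a b hne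
    have : 0 < δ * t ^ n := by positivity
    rw [hab, dist_self] at h
    linarith
  set f : Z → ℝ := fun z ↦ Real.ofDigits (Function.invFun φ z) with hf
  have hfφ (a : ℕ → Fin 2) : f (φ a) = Real.ofDigits a := by
    simp only [hf, Function.leftInverse_invFun hinj a]
  set C : ℝ≥0 := ⟨(δ ^ (s : ℝ))⁻¹, by positivity⟩
  have hholder : HolderOnWith C s f (range φ) := by
    rintro _ ⟨a, rfl⟩ _ ⟨b, rfl⟩
    rw [hfφ, hfφ, edist_dist, edist_dist, ENNReal.ofReal_rpow_of_nonneg dist_nonneg s.coe_nonneg,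
      ← ENNReal.ofReal_coe_nnreal, ← ENNReal.ofReal_mul C.coe_nonneg]
    apply ENNReal.ofReal_le_ofReal
    rcases eq_or_ne a b with rfl | hab
    · rw [dist_self]
      positivity
    obtain ⟨n, hn, h⟩ := hsep a b hab
    rw [Real.dist_eq]
    refine (Real.abs_ofDigits_sub_ofDigits_le hn).trans ?_
    have hpow : (δ * t ^ n) ^ (s : ℝ) = δ ^ (s : ℝ) * ((2 : ℝ) ^ n)⁻¹ := by
      rw [Real.mul_rpow hδ.le (by positivity), ← Real.rpow_natCast, ← Real.rpow_mul ht.le,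
        mul_comm (n : ℝ), Real.rpow_mul ht.le, hts, Real.rpow_natCast, inv_pow]
    calc (((2 : ℕ) : ℝ) ^ n)⁻¹ = (δ ^ (s : ℝ))⁻¹ * (δ * t ^ n) ^ (s : ℝ) := by
          rw [hpow, inv_mul_cancel_left₀ (by positivity)]
          norm_num
      _ ≤ (δ ^ (s : ℝ))⁻¹ * dist (φ a) (φ b) ^ (s : ℝ) := by gcongr
  have himage : Icc (0 : ℝ) 1 ⊆ f '' range φ := by
    intro x hx
    obtain ⟨a, -, rfl⟩ := Real.ofDigits_SurjOn (b := 2) one_lt_two hx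
    exact ⟨φ a, mem_range_self a, hfφ a⟩
  have hIcc : dimH (Icc (0 : ℝ) 1) = 1 := by
    rw [Real.dimH_of_nonempty_interior (by simp [interior_Icc]), Module.finrank_self,
      Nat.cast_one]
  have h := (hIcc ▸ dimH_mono himage).trans (hholder.dimH_image_le hs)
  rwa [ENNReal.le_div_iff_mul_le (by simp [hs.ne']) (by simp), one_mul] at h

/-- The centres of the balls of a binary tree: starting at `x`, the `n`-th digit decides whether
to stay at the current centre or to move to the point given by `Y n`. -/
def binaryTreeCentre {Z : Type*} (x : Z) (Y : ℕ → Z → Z) (a : ℕ → Fin 2) : ℕ → Z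
  | 0 => x
  | n + 1 => if a n = 0 then binaryTreeCentre x Y a n else Y n (binaryTreeCentre x Y a n)

lemma binaryTreeCentre_congr {Z : Type*} (x : Z) (Y : ℕ → Z → Z) {a b : ℕ → Fin 2} {n : ℕ}
    (h : ∀ i < n, a i = b i) : binaryTreeCentre x Y a n = binaryTreeCentre x Y b n := by
  induction n with
  | zero => rfl
  | succ n ih =>
    simp only [binaryTreeCentre, h n n.lt_succ_self, ih fun i hi ↦ h i (hi.trans n.lt_succ_self)]

/-- A complete metric space in which every point `x` and every radius `r ≤ R` admit a point at
distance in `(r / S, r]` from `x` contains a Cantor set of contraction ratio `t`, for every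
`t < 1 / (2 * S + 1)`. -/
lemma exists_binary_separated {Z : Type*} [MetricSpace Z] [CompleteSpace Z] (x : Z)
    {S R t : ℝ} (hS : 0 < S) (hR : 0 < R) (ht : 0 < t) (htS : t * (2 * S + 1) < 1)
    (hup : ∀ (z : Z) (r : ℝ), 0 < r → r < R → ∃ y : Z, r / S < dist z y ∧ dist z y ≤ r) :
    ∃ φ : (ℕ → Fin 2) → Z, ∃ δ : ℝ, 0 < δ ∧ ∀ (a b : ℕ → Fin 2) (n : ℕ),
      (∀ i < n, a i = b i) → a n ≠ b n → δ * t ^ n ≤ dist (φ a) (φ b) := by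
  have ht1 : t < 1 := by nlinarith [mul_pos ht hS]
  have h1t : 0 < 1 - t := sub_pos.2 ht1
  have hr0 (n : ℕ) : 0 < (1 - t) * R * t ^ n := by positivity
  have hrR (n : ℕ) : (1 - t) * R * t ^ n < R := by
    have := pow_le_one₀ (n := n) ht.le ht1.le
    nlinarith [mul_pos ht hR, mul_pos h1t hR]
  choose Y hY using fun (n : ℕ) (z : Z) ↦ hup z _ (hr0 n) (hrR n)
  set c := binaryTreeCentre x Y with hc
  have hstep (a : ℕ → Fin 2) (n : ℕ) : dist (c a n) (c a (n + 1)) ≤ (1 - t) * R * t ^ n := by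
    simp only [hc, binaryTreeCentre]
    split_ifs
    · rw [dist_self]
      exact (hr0 n).le
    · exact (hY n _).2
  choose φ hφ using fun a ↦ cauchySeq_tendsto_of_complete
    (cauchySeq_of_le_geometric t _ ht1 (hstep a))
  have hdist (a : ℕ → Fin 2) (n : ℕ) : dist (c a n) (φ a) ≤ R * t ^ n := by
    have := dist_le_of_le_geometric_of_tendsto t _ ht1 (hstep a) (hφ a) n
    rwa [mul_assoc (1 - t), mul_div_cancel_left₀ _ h1t.ne'] at this
  have hδ : 0 < (1 - t) / S - 2 * t := by
    rw [sub_pos, lt_div_iff₀ hS]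
    linarith
  have hkey (a b : ℕ → Fin 2) (n : ℕ) (h : ∀ i < n, a i = b i) (ha : a n = 0) (hb : b n ≠ 0) :
      R * ((1 - t) / S - 2 * t) * t ^ n ≤ dist (φ a) (φ b) := by
    have hca : c a (n + 1) = c b n := by
      simp only [hc, ← binaryTreeCentre_congr x Y h, binaryTreeCentre, ha, if_true]
    have hcb : c b (n + 1) = Y n (c b n) := by
      simp only [hc, binaryTreeCentre, hb, if_false]
    have h1 := (hY n (c b n)).1
    rw [← hcb, ← hca] at h1
    have h2 := dist_triangle4 (c a (n + 1)) (φ a) (φ b) (c b (n + 1))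
    have h3 := hdist a (n + 1)
    have h4 := hdist b (n + 1)
    rw [dist_comm (φ b)] at h2
    have h5 : R * ((1 - t) / S - 2 * t) * t ^ n
        = (1 - t) * R * t ^ n / S - 2 * (R * t ^ (n + 1)) := by ring
    linarith
  refine ⟨φ, R * ((1 - t) / S - 2 * t), by positivity, fun a b n h hne ↦ ?_⟩
  rcases eq_or_ne (a n) 0 with ha | ha
  · exact hkey a b n h ha fun hb ↦ hne (ha.trans hb.symm)
  · rw [dist_comm]
    exact hkey b a n (fun i hi ↦ (h i hi).symm) (by lia) ha


/-- Corollary 7.4: A compact doubling metric space with at least two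
points which is uniformly perfect with constant `S > 1` has Hausdorff dimension at
least `log 2 / log(2S+1) > 0`. -/
theorem stmt_17 {Z : Type*} [MetricSpace Z] [CompactSpace Z]
    [MeasurableSpace Z] [BorelSpace Z]
    (hZ : ∃ x y : Z, x ≠ y)
    (hdouble : ∃ M : ℕ, ∀ (x : Z) (r : ℝ), ∃ F : Finset Z, F.card ≤ M ∧
      Metric.closedBall x (2 * r) ⊆ ⋃ y ∈ F, Metric.closedBall y r)
    (S : ℝ) (hS : 1 < S)
    (hup : ∀ (x : Z) (r : ℝ), 0 < r →
      ENNReal.ofReal r < EMetric.diam (Set.univ : Set Z) →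
      ∃ y : Z, r / S < dist x y ∧ dist x y ≤ r) :
    ENNReal.ofReal (Real.log 2 / Real.log (2 * S + 1)) ≤ dimH (Set.univ : Set Z) ∧
      0 < Real.log 2 / Real.log (2 * S + 1) := by
  have hlog : 0 < Real.log (2 * S + 1) := Real.log_pos (by linarith)
  have hpos : 0 < Real.log 2 / Real.log (2 * S + 1) := div_pos (Real.log_pos one_lt_two) hlog
  refine ⟨le_of_forall_lt_imp_le_of_dense fun u hu ↦ ?_, hpos⟩
  lift u to ℝ≥0 using hu.ne_top with s
  rcases eq_or_ne s 0 with rfl | hs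
  · simp
  have hs' : 0 < (s : ℝ) := by positivity
  replace hu : (s : ℝ) < Real.log 2 / Real.log (2 * S + 1) := by
    rw [← ENNReal.ofReal_coe_nnreal] at hu
    exact (ENNReal.ofReal_lt_ofReal_iff hpos).1 hu
  obtain ⟨x, y, hxy⟩ := hZ
  have ht : 0 < (2 : ℝ)⁻¹ ^ (s : ℝ)⁻¹ := by positivity
  have htS : (2 : ℝ)⁻¹ ^ (s : ℝ)⁻¹ * (2 * S + 1) < 1 := by
    rw [← Real.log_neg_iff (by positivity), Real.log_mul ht.ne' (by positivity),
      Real.log_rpow (by positivity), Real.log_inv]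
    rw [lt_div_iff₀ hlog, ← lt_inv_mul_iff₀ hs'] at hu
    linarith
  obtain ⟨φ, δ, hδ, hφ⟩ := exists_binary_separated x (zero_lt_one.trans hS) (dist_pos.2 hxy) ht htS
    fun z r hr hrR ↦ hup z r hr <| by
      refine lt_of_lt_of_le ?_ (edist_le_ediam_of_mem (mem_univ x) (mem_univ y))
      rw [edist_dist]
      exact (ENNReal.ofReal_lt_ofReal_iff (dist_pos.2 hxy)).2 hrR
  exact (le_dimH_range_of_binary_separated φ ht hδ (pos_iff_ne_zero.2 hs)
    (Real.rpow_inv_rpow (by positivity) hs'.ne') hφ).trans (dimH_mono (subset_univ _))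
end
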